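/- Let K ∈ ℕ and let t : ℕ → ℝ satisfy t k ≤ t (k+1) for every k < K. Let 0 ≤ a ≤ b be real numbers, let i < K, and let P₁, P₂ : ℝ → Prop. Assume (cover) Icc (t i + a) (t (i+1) + b) ⊆ Icc (t 0) (t K), and assume that for every j < K with Icc (t j) (t (j+1)) ∩ Icc (t i + a) (t (i+1) + b) ≠ ∅, either P₂ s holds for every s ∈ Icc (t j) (t (j+1)), or there exist l < j and τ'' ∈ Icc (t l) (t (l+1)) ∩ Icc (t (i+1)) (t (i+1) + b) such that P₁ s holds for every s ∈ Icc (t l) (t (l+1)). Then for every τ ∈ Icc (t i) (t (i+1)) and every τ' ∈ Icc (τ + a) (τ + b), either P₂ τ' holds, or there exists τ'' ∈ Icc τ τ' with P₁ τ''. -/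

import Mathlib

theorem exists_mem_Icc_succ {α : Type*} [LinearOrder α] {t : ℕ → α} {x : α} (h₀ : t 0 ≤ x)
    {n : ℕ} (hn : 0 < n) (hx : x ≤ t n) : ∃ j < n, x ∈ Set.Icc (t j) (t (j + 1)) := by
  induction n, hn using Nat.le_induction with
  | base => exact ⟨0, Nat.one_pos, h₀, hx⟩
  | succ n hn ih =>
    rcases le_total x (t n) with h | h
    · obtain ⟨j, hj, hmem⟩ := ih h
      exact ⟨j, hj.trans n.lt_succ_self, hmem⟩
    · exact ⟨n, n.lt_succ_self, h, hx⟩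

theorem le_of_le_succ_of_lt {α : Type*} [Preorder α] {t : ℕ → α} {K : ℕ}
    (ht : ∀ k < K, t k ≤ t (k + 1)) {m n : ℕ} (hmn : m ≤ n) (hn : n ≤ K) : t m ≤ t n := by
  induction n, hmn using Nat.le_induction with
  | base => exact le_rfl
  | succ n _ ih => exact (ih (Nat.le_of_succ_le hn)).trans (ht n hn)

theorem stmt_12 (K : ℕ) (t : ℕ → ℝ) (ht : ∀ k < K, t k ≤ t (k + 1))
    (a b : ℝ) (ha : 0 ≤ a) (hab : a ≤ b) (i : ℕ) (hi : i < K)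
    (P₁ P₂ : ℝ → Prop)
    (hcover : Set.Icc (t i + a) (t (i + 1) + b) ⊆ Set.Icc (t 0) (t K))
    (henc : ∀ j < K,
      Set.Icc (t j) (t (j + 1)) ∩ Set.Icc (t i + a) (t (i + 1) + b) ≠ ∅ →
      (∀ s ∈ Set.Icc (t j) (t (j + 1)), P₂ s) ∨
      (∃ l < j, ∃ τ'' ∈ Set.Icc (t l) (t (l + 1)) ∩
          Set.Icc (t (i + 1)) (t (i + 1) + b),
        ∀ s ∈ Set.Icc (t l) (t (l + 1)), P₁ s)) :
    ∀ τ ∈ Set.Icc (t i) (t (i + 1)), ∀ τ' ∈ Set.Icc (τ + a) (τ + b),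
      P₂ τ' ∨ ∃ τ'' ∈ Set.Icc τ τ', P₁ τ'' := by
  rintro τ ⟨hτ₁, hτ₂⟩ τ' ⟨hτ'₁, hτ'₂⟩
  have hmem : τ' ∈ Set.Icc (t i + a) (t (i + 1) + b) := ⟨by linarith, by linarith⟩
  obtain ⟨h₀, hK⟩ := hcover hmem
  obtain ⟨j, hj, hjmem⟩ := exists_mem_Icc_succ h₀ (Nat.zero_lt_of_lt hi) hK
  rcases henc j hj (Set.Nonempty.ne_empty ⟨τ', hjmem, hmem⟩) with h | ⟨l, hl, τ'', ⟨hτl, hτi⟩, h⟩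
  · exact Or.inl (h τ' hjmem)
  · exact Or.inr ⟨τ'', ⟨hτ₂.trans hτi.1,
      (hτl.2.trans (le_of_le_succ_of_lt ht hl hj.le)).trans hjmem.1⟩, h τ'' hτl⟩
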